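/- arXiv:1902.08557 — 8 statements merged into one kernel-verified Lean document; each statement's English description precedes it below -/
import Mathlib

section
/- Every linear code C of length n over R decomposes as C = vC₁ ⊕ (1−v)C₂; that is, C = {vx + (1−v)y : x ∈ C₁, y ∈ C₂}, and moreover C₁ and C₂ are linear codes of length n over 𝔽_q (i.e. 𝔽_q-subspaces of 𝔽_qⁿ). -/
open scoped BigOperators

/-- The ring `R = 𝔽_q + v 𝔽_q`, `v² = v`, realized concretely as `F × F`
via the `F`-algebra isomorphism `a + v b ↦ (a, a + b)`. -/
abbrev Rg (F : Type) := F × F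

/-- The element `v` of `R`: under the identification above, `v = (0, 1)`. -/
def vv (F : Type) [Field F] : Rg F := (0, 1)

/-- The element `v • x + (1 - v) • y` of `Rⁿ`, for `x, y ∈ Fⁿ`. -/
def mix {F : Type} [Field F] {n : ℕ} (x y : Fin n → F) : Fin n → Rg F :=
  fun i => vv F * algebraMap F (Rg F) (x i) + (1 - vv F) * algebraMap F (Rg F) (y i)

/-- `v A ⊕ (1 - v) B = {v a + (1-v) b : a ∈ A, b ∈ B}`. -/
def mixSet {F : Type} [Field F] {n : ℕ} (A B : Set (Fin n → F)) : Set (Fin n → Rg F) :=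
  {c | ∃ x ∈ A, ∃ y ∈ B, c = mix x y}

/-- Euclidean dual (of an arbitrary subset). -/
def dualE {K : Type} [CommRing K] {n : ℕ} (C : Set (Fin n → K)) : Set (Fin n → K) :=
  {x | ∀ y ∈ C, ∑ i, x i * y i = 0}

/-- Hermitian dual w.r.t. a conjugation map. -/
def dualH {K : Type} [CommRing K] (conj : K → K) {n : ℕ} (C : Set (Fin n → K)) :
    Set (Fin n → K) :=
  {x | ∀ y ∈ C, ∑ i, x i * conj (y i) = 0}

/-- The map `a + v b ↦ a ^ e + v * b ^ e` on `R` (i.e. the extension of `x ↦ x ^ e`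
from `F` to `R`); used for `θ_r` (`e = p ^ r`) and for conjugation (`e = p ^ (t/2)`). -/
def thR (F : Type) [Field F] (e : ℕ) : Rg F → Rg F :=
  fun z => (z.1 ^ e, z.1 ^ e + (z.2 - z.1) ^ e)

/-- The skew `λ`-constacyclic shift
`(c₀, …, c_{n-1}) ↦ (λ θ(c_{n-1}), θ(c₀), …, θ(c_{n-2}))`. -/
def skewShift {K : Type} [Mul K] (th : K → K) (lam : K) {n : ℕ} (c : Fin n → K) :
    Fin n → K :=
  fun i =>
    if (i : ℕ) = 0 then
      lam * th (c ⟨n - 1, Nat.sub_lt (Nat.lt_of_le_of_lt (Nat.zero_le _) i.isLt) Nat.one_pos⟩)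
    else th (c ⟨(i : ℕ) - 1, Nat.lt_of_le_of_lt (Nat.sub_le _ _) i.isLt⟩)

/-- A set of words is skew `λ`-constacyclic if it is stable under the skew shift. -/
def SkewConsta {K : Type} [Mul K] (th : K → K) (lam : K) {n : ℕ}
    (C : Set (Fin n → K)) : Prop :=
  ∀ c ∈ C, skewShift th lam c ∈ C

/-- `[i] = (p^{ri} - 1)/(p^r - 1) = 1 + p^r + ⋯ + p^{r(i-1)}` (so `[0] = 0`). -/
def brk (p r i : ℕ) : ℕ := ∑ j ∈ Finset.range i, p ^ (r * j)

/-- The monomial map `ψ_δ : (c₀, …, c_{n-1}) ↦ (δ^{[0]} c₀, …, δ^{[n-1]} c_{n-1})`. -/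
def psi {K : Type} [Monoid K] (p r : ℕ) (δ : K) {n : ℕ} (c : Fin n → K) : Fin n → K :=
  fun i => δ ^ brk p r (i : ℕ) * c i

/-- A set is a linear code over `K` if it is (the carrier of) a `K`-submodule. -/
def IsLinCode (K : Type) [Semiring K] {M : Type} [AddCommMonoid M] [Module K M]
    (S : Set M) : Prop :=
  ∃ C : Submodule K M, ↑C = S

/-- The Gray map `Φ(a + v b) = (a, a + b)`, componentwise; under the identification
`R = F × F` it is the canonical unzip `Rⁿ ≅ Fⁿ × Fⁿ`. -/
def gray {F : Type} [Field F] {n : ℕ} (c : Fin n → Rg F) : (Fin n → F) × (Fin n → F) :=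
  (fun i => (c i).1, fun i => (c i).2)

/-- Euclidean dual in `F^{2n} ≅ Fⁿ × Fⁿ` w.r.t. the standard inner product. -/
def dualProd {F : Type} [Field F] {n : ℕ} (S : Set ((Fin n → F) × (Fin n → F))) :
    Set ((Fin n → F) × (Fin n → F)) :=
  {x | ∀ y ∈ S, (∑ i, x.1 i * y.1 i) + (∑ i, x.2 i * y.2 i) = 0}

theorem mix_apply {F : Type} [Field F] {n : ℕ} (x y : Fin n → F) (i : Fin n) :
    mix x y i = (y i, x i) := by
  ext <;> simp [mix, vv]

theorem mix_snd_fst {F : Type} [Field F] {n : ℕ} (c : Fin n → Rg F) :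
    mix (fun i => (c i).2) (fun i => (c i).1) = c := by
  ext i <;> simp [mix_apply]

theorem mix_zero {F : Type} [Field F] {n : ℕ} : mix (0 : Fin n → F) 0 = 0 := by
  ext i <;> simp [mix_apply]

theorem mix_add {F : Type} [Field F] {n : ℕ} (x x' y y' : Fin n → F) :
    mix (x + x') (y + y') = mix x y + mix x' y' := by
  ext i <;> simp [mix_apply]

theorem mix_smul {F : Type} [Field F] {n : ℕ} (a : F) (x y : Fin n → F) :
    mix (a • x) (a • y) = algebraMap F (Rg F) a • mix x y := by
  ext i <;> simp [mix_apply]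

theorem vv_smul_mix_add {F : Type} [Field F] {n : ℕ} (x x' y y' : Fin n → F) :
    vv F • mix x y' + (1 - vv F) • mix x' y = mix x y := by
  ext i <;> simp [mix_apply, vv]

/-- every linear code `C` over `R` decomposes as `C = vC₁ ⊕ (1-v)C₂`,
and `C₁`, `C₂` are linear codes over `𝔽_q`. -/
theorem stmt0 (p t n : ℕ) (hp : p.Prime) (ht : 0 < t)
    (F : Type) [Field F] [Fintype F] (hF : Fintype.card F = p ^ t)
    (C : Submodule (Rg F) (Fin n → Rg F)) :
    (↑C : Set (Fin n → Rg F)) =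
      mixSet {x | ∃ y, mix x y ∈ C} {y | ∃ x, mix x y ∈ C} ∧
    IsLinCode F ({x | ∃ y, mix x y ∈ C} : Set (Fin n → F)) ∧
    IsLinCode F ({y | ∃ x, mix x y ∈ C} : Set (Fin n → F)) := by
  refine ⟨Set.ext fun c => ⟨fun hc => ?_, ?_⟩, ⟨⟨⟨⟨_, ?_⟩, ?_⟩, ?_⟩, rfl⟩, ⟨⟨⟨⟨_, ?_⟩, ?_⟩, ?_⟩, rfl⟩⟩
  · have h : mix (fun i => (c i).2) (fun i => (c i).1) ∈ C := by rwa [mix_snd_fst]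
    exact ⟨_, ⟨_, h⟩, _, ⟨_, h⟩, (mix_snd_fst c).symm⟩
  · rintro ⟨x, ⟨y', hx⟩, y, ⟨x', hy⟩, rfl⟩
    rw [SetLike.mem_coe, ← vv_smul_mix_add x x' y y']
    exact C.add_mem (C.smul_mem _ hx) (C.smul_mem _ hy)
  · rintro x x' ⟨y, h⟩ ⟨y', h'⟩
    exact ⟨y + y', mix_add x x' y y' ▸ C.add_mem h h'⟩
  · exact ⟨0, (mix_zero (F := F) (n := n)).symm ▸ C.zero_mem⟩
  · rintro a x ⟨y, h⟩
    exact ⟨a • y, mix_smul a x y ▸ C.smul_mem _ h⟩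
  · rintro y y' ⟨x, h⟩ ⟨x', h'⟩
    exact ⟨x + x', mix_add x x' y y' ▸ C.add_mem h h'⟩
  · exact ⟨0, (mix_zero (F := F) (n := n)).symm ▸ C.zero_mem⟩
  · rintro a y ⟨x, h⟩
    exact ⟨a • x, mix_smul a x y ▸ C.smul_mem _ h⟩
end

section
/- For linear codes C₁, C₂ of length n over 𝔽_q, the Euclidean dual of the linear code C = vC₁ ⊕ (1−v)C₂ over R is C^⊥ = vC₁^⊥ ⊕ (1−v)C₂^⊥, where C₁^⊥ and C₂^⊥ are the Euclidean duals of C₁ and C₂ in 𝔽_qⁿ. -/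
open scoped BigOperators

theorem sum_mul_mix {F : Type} [Field F] {n : ℕ} (c : Fin n → Rg F) (x y : Fin n → F) :
    ∑ i, c i * mix x y i = (∑ i, (c i).1 * y i, ∑ i, (c i).2 * x i) := by
  simp [mix_apply, Prod.ext_iff, Prod.fst_sum, Prod.snd_sum]

theorem mem_mixSet {F : Type} [Field F] {n : ℕ} {A B : Set (Fin n → F)} {c : Fin n → Rg F} :
    c ∈ mixSet A B ↔ (fun i => (c i).2) ∈ A ∧ (fun i => (c i).1) ∈ B := by
  constructor
  · rintro ⟨x, hx, y, hy, rfl⟩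
    simpa only [mix_apply] using And.intro hx hy
  · rintro ⟨hx, hy⟩
    exact ⟨_, hx, _, hy, funext fun i => by rw [mix_apply]⟩

/-- the Euclidean dual of `C = vC₁ ⊕ (1-v)C₂` is `vC₁^⊥ ⊕ (1-v)C₂^⊥`. -/
theorem stmt2 (p t n : ℕ) (hp : p.Prime) (ht : 0 < t)
    (F : Type) [Field F] [Fintype F] (hF : Fintype.card F = p ^ t)
    (C₁ C₂ : Submodule F (Fin n → F)) :
    dualE (mixSet (↑C₁ : Set (Fin n → F)) (↑C₂ : Set (Fin n → F))) =
      mixSet (dualE (↑C₁ : Set (Fin n → F))) (dualE (↑C₂ : Set (Fin n → F))) := by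
  ext c
  rw [mem_mixSet]
  constructor
  · intro h
    refine ⟨fun x hx => ?_, fun y hy => ?_⟩
    · have h0 := h _ ⟨x, hx, 0, C₂.zero_mem, rfl⟩
      rw [sum_mul_mix] at h0
      exact congrArg Prod.snd h0
    · have h0 := h _ ⟨0, C₁.zero_mem, y, hy, rfl⟩
      rw [sum_mul_mix] at h0
      exact congrArg Prod.fst h0
  · rintro ⟨h₁, h₂⟩ _ ⟨x, hx, y, hy, rfl⟩
    rw [sum_mul_mix]
    exact Prod.ext (h₂ y hy) (h₁ x hx)
end

section
/- Let α and β be nonzero elements of the fixed field 𝔽_{p^r} ⊆ 𝔽_q of θ_r with α + β ≠ 0, and let C₁, C₂ be linear codes of length n over 𝔽_q. Then the linear code C = vC₁ ⊕ (1−v)C₂ over R is skew (α+vβ)-constacyclic with respect to θ_r if and only if C₁ is a skew (α+β)-constacyclic code and C₂ is a skew α-constacyclic code over 𝔽_q with respect to θ_r. -/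
open scoped BigOperators

theorem mix_injective {F : Type} [Field F] {n : ℕ} {x y x' y' : Fin n → F}
    (h : mix x y = mix x' y') : x = x' ∧ y = y' := by
  constructor <;> funext i <;> have hi := congrFun h i <;>
    rw [mix_apply, mix_apply, Prod.mk.injEq] at hi
  exacts [hi.2, hi.1]

theorem mix_mem_mixSet {F : Type} [Field F] {n : ℕ} {A B : Set (Fin n → F)} {x y : Fin n → F} :
    mix x y ∈ mixSet A B ↔ x ∈ A ∧ y ∈ B := by
  constructor
  · rintro ⟨x', hx, y', hy, h⟩
    obtain ⟨rfl, rfl⟩ := mix_injective h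
    exact ⟨hx, hy⟩
  · rintro ⟨hx, hy⟩
    exact ⟨x, hx, y, hy, rfl⟩

/-- In characteristic `p`, the extension of `x ↦ x ^ p ^ r` to `R` acts componentwise. -/
theorem thR_prime_pow (F : Type) [Field F] (p r : ℕ) [ExpChar F p] (z : Rg F) :
    thR F (p ^ r) z = (z.1 ^ p ^ r, z.2 ^ p ^ r) := by
  simp [thR, sub_pow_expChar_pow]

theorem skewShift_mix {F : Type} [Field F] (p r : ℕ) [ExpChar F p] {n : ℕ} (α β : F)
    (x y : Fin n → F) :
    skewShift (thR F (p ^ r)) (algebraMap F (Rg F) α + vv F * algebraMap F (Rg F) β) (mix x y) =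
      mix (skewShift (fun a : F => a ^ p ^ r) (α + β) x)
        (skewShift (fun a : F => a ^ p ^ r) α y) := by
  funext i
  rw [mix_apply]
  by_cases hi : (i : ℕ) = 0
  · ext <;> simp [skewShift, hi, mix_apply, thR_prime_pow, vv]
  · simp [skewShift, hi, mix_apply, thR_prime_pow]

/-- `C = vC₁ ⊕ (1-v)C₂` is skew `(α + vβ)`-constacyclic w.r.t. `θ_r` iff
`C₁` is skew `(α+β)`-constacyclic and `C₂` is skew `α`-constacyclic over `𝔽_q`,
for `α, β` nonzero elements of the fixed field of `θ_r` with `α + β ≠ 0`. -/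
theorem stmt4 (p t r n : ℕ) (hp : p.Prime) (ht : 0 < t) (hr : r ∣ t)
    (F : Type) [Field F] [Fintype F] (hF : Fintype.card F = p ^ t)
    (α β : F) (hα : α ≠ 0) (hβ : β ≠ 0) (hαβ : α + β ≠ 0)
    (hαfix : α ^ p ^ r = α) (hβfix : β ^ p ^ r = β)
    (C₁ C₂ : Submodule F (Fin n → F)) :
    SkewConsta (thR F (p ^ r))
        (algebraMap F (Rg F) α + vv F * algebraMap F (Rg F) β)
        (mixSet (↑C₁ : Set (Fin n → F)) (↑C₂ : Set (Fin n → F))) ↔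
      SkewConsta (fun a : F => a ^ p ^ r) (α + β) (↑C₁ : Set (Fin n → F)) ∧
      SkewConsta (fun a : F => a ^ p ^ r) α (↑C₂ : Set (Fin n → F)) := by
  have : Fact p.Prime := ⟨hp⟩
  have : CharP F p := charP_of_card_eq_prime_pow hF
  have : ExpChar F p := ExpChar.prime hp
  constructor
  · intro h
    have key : ∀ x ∈ C₁, ∀ y ∈ C₂,
        skewShift (fun a : F => a ^ p ^ r) (α + β) x ∈ (C₁ : Set (Fin n → F)) ∧
          skewShift (fun a : F => a ^ p ^ r) α y ∈ (C₂ : Set (Fin n → F)) := by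
      intro x hx y hy
      rw [← mix_mem_mixSet, ← skewShift_mix]
      exact h _ (mix_mem_mixSet.2 ⟨hx, hy⟩)
    exact ⟨fun x hx => (key x hx 0 C₂.zero_mem).1, fun y hy => (key 0 C₁.zero_mem y hy).2⟩
  · rintro ⟨h₁, h₂⟩ _ ⟨x, hx, y, hy, rfl⟩
    rw [skewShift_mix, mix_mem_mixSet]
    exact ⟨h₁ x hx, h₂ y hy⟩
end

section
/- Let δ ∈ 𝔽_q^* and μ ∈ 𝔽_q^*. The monomial map ψ_δ : 𝔽_qⁿ → 𝔽_qⁿ is an 𝔽_q-linear bijection preserving Hamming weight, and for every skew μ-constacyclic linear code C of length n over 𝔽_q (with respect to θ_r), the image ψ_δ(C) is a skew μδ^{−[n]}-constacyclic linear code of length n over 𝔽_q (with respect to θ_r). Consequently ψ_δ induces a bijection from the set of skew μ-constacyclic codes of length n onto the set of skew μδ^{−[n]}-constacyclic codes of length n. -/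
open scoped BigOperators

lemma brk_zero (p r : ℕ) : brk p r 0 = 0 := by
  simp [brk]

lemma brk_succ (p r i : ℕ) : brk p r (i + 1) = brk p r i * p ^ r + 1 := by
  simp only [brk, Finset.sum_range_succ', Finset.sum_mul]
  congr 1
  · exact Finset.sum_congr rfl fun j _ => by ring

section Psi

variable {F : Type} [Field F] {n : ℕ} {p r : ℕ} {δ : F}

lemma isLinearMap_psi (p r : ℕ) (δ : F) : IsLinearMap F (psi p r δ (n := n)) where
  map_add x y := by ext i; simp [psi, mul_add]
  map_smul c x := by ext i; simp [psi, mul_left_comm]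

lemma psi_inv_psi (hδ : δ ≠ 0) (c : Fin n → F) : psi p r δ⁻¹ (psi p r δ c) = c := by
  ext i
  simp [psi, hδ]

lemma psi_psi_inv (hδ : δ ≠ 0) (c : Fin n → F) : psi p r δ (psi p r δ⁻¹ c) = c := by
  ext i
  simp [psi, hδ]

lemma bijective_psi (hδ : δ ≠ 0) : Function.Bijective (psi p r δ (n := n)) :=
  Function.bijective_iff_has_inverse.2
    ⟨psi p r δ⁻¹, psi_inv_psi hδ, psi_psi_inv hδ⟩

lemma hammingNorm_psi [DecidableEq F] (hδ : δ ≠ 0) (x : Fin n → F) :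
    hammingNorm (psi p r δ x) = hammingNorm x := by
  simp [hammingNorm, psi, hδ]

lemma psi_skewShift (hδ : δ ≠ 0) (μ : F) (c : Fin n → F) :
    psi p r δ (skewShift (fun a : F => a ^ p ^ r) μ c) =
      δ • skewShift (fun a : F => a ^ p ^ r) (μ * (δ ^ brk p r n)⁻¹) (psi p r δ c) := by
  ext ⟨i, hi⟩
  rcases i with _ | i
  · obtain ⟨m, rfl⟩ : ∃ m, n = m + 1 := ⟨n - 1, by omega⟩
    simp only [psi, skewShift, Pi.smul_apply, smul_eq_mul, if_true, brk_zero, brk_succ,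
      Nat.add_sub_cancel, mul_pow, ← pow_mul, pow_succ δ]
    field_simp
  · simp only [psi, skewShift, Pi.smul_apply, smul_eq_mul, brk_succ, Nat.add_sub_cancel,
      Nat.succ_ne_zero, if_false, mul_pow, ← pow_mul, pow_succ δ]
    ring

lemma isLinCode_image_psi {S : Set (Fin n → F)} (hS : IsLinCode F S) :
    IsLinCode F (psi p r δ '' S) := by
  obtain ⟨C, rfl⟩ := hS
  exact ⟨C.map (isLinearMap_psi p r δ).mk', Submodule.map_coe _ _⟩

lemma skewConsta_image_psi {μ : F} (hδ : δ ≠ 0) {S : Set (Fin n → F)} (hS : IsLinCode F S)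
    (h : SkewConsta (fun a : F => a ^ p ^ r) μ S) :
    SkewConsta (fun a : F => a ^ p ^ r) (μ * (δ ^ brk p r n)⁻¹) (psi p r δ '' S) := by
  obtain ⟨C, rfl⟩ := hS
  rintro _ ⟨c, hc, rfl⟩
  refine ⟨δ⁻¹ • skewShift (fun a : F => a ^ p ^ r) μ c, C.smul_mem _ (h c hc), ?_⟩
  rw [(isLinearMap_psi p r δ).map_smul, psi_skewShift hδ, inv_smul_smul₀ hδ]

lemma bijOn_image_psi (hδ : δ ≠ 0) (μ : F) :
    Set.BijOn (Set.image (psi p r δ))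
      {S : Set (Fin n → F) | IsLinCode F S ∧ SkewConsta (fun a : F => a ^ p ^ r) μ S}
      {S : Set (Fin n → F) | IsLinCode F S ∧
        SkewConsta (fun a : F => a ^ p ^ r) (μ * (δ ^ brk p r n)⁻¹) S} := by
  refine Set.InvOn.bijOn (f' := Set.image (psi p r δ⁻¹)) ⟨fun S _ => ?_, fun S _ => ?_⟩
    (fun S hS => ⟨isLinCode_image_psi hS.1, skewConsta_image_psi hδ hS.1 hS.2⟩)
    (fun S hS => ⟨isLinCode_image_psi hS.1, ?_⟩)
  · simp [Set.image_image, psi_inv_psi hδ]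
  · simp [Set.image_image, psi_psi_inv hδ]
  · simpa [mul_assoc, hδ] using skewConsta_image_psi (inv_ne_zero hδ) hS.1 hS.2

end Psi

/-- `ψ_δ` is an `𝔽_q`-linear Hamming-weight-preserving bijection that sends
skew `μ`-constacyclic linear codes to skew `μδ^{-[n]}`-constacyclic linear codes, and it
induces a bijection between the corresponding sets of codes. -/
theorem stmt5 (p t r n : ℕ) (hp : p.Prime) (ht : 0 < t) (hr : r ∣ t)
    (F : Type) [Field F] [Fintype F] [DecidableEq F] (hF : Fintype.card F = p ^ t)
    (δ μ : F) (hδ : δ ≠ 0) (hμ : μ ≠ 0) :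
    IsLinearMap F (psi p r δ (n := n)) ∧
    Function.Bijective (psi p r δ (n := n)) ∧
    (∀ x : Fin n → F, hammingNorm (psi p r δ x) = hammingNorm x) ∧
    (∀ C : Submodule F (Fin n → F),
      SkewConsta (fun a : F => a ^ p ^ r) μ (↑C : Set (Fin n → F)) →
        IsLinCode F (psi p r δ '' (↑C : Set (Fin n → F))) ∧
        SkewConsta (fun a : F => a ^ p ^ r) (μ * (δ ^ brk p r n)⁻¹)
          (psi p r δ '' (↑C : Set (Fin n → F)))) ∧
    Set.BijOn (Set.image (psi p r δ))
      {S : Set (Fin n → F) | IsLinCode F S ∧ SkewConsta (fun a : F => a ^ p ^ r) μ S}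
      {S : Set (Fin n → F) | IsLinCode F S ∧
        SkewConsta (fun a : F => a ^ p ^ r) (μ * (δ ^ brk p r n)⁻¹) S} := by
  exact ⟨isLinearMap_psi p r δ, bijective_psi hδ, hammingNorm_psi hδ,
    fun C hC => ⟨isLinCode_image_psi ⟨C, rfl⟩, skewConsta_image_psi hδ ⟨C, rfl⟩ hC⟩,
    bijOn_image_psi hδ μ⟩
end

section
/- For linear codes C₁, C₂ of length n over 𝔽_q and the linear code C = vC₁ ⊕ (1−v)C₂ over R, the hull of C decomposes as C ∩ C^⊥ = v(C₁ ∩ C₁^⊥) ⊕ (1−v)(C₂ ∩ C₂^⊥), where all duals are Euclidean duals. -/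
open scoped BigOperators

theorem sum_mix_mul_mix {F : Type} [Field F] {n : ℕ} (x y a b : Fin n → F) :
    ∑ i, mix x y i * mix a b i = (∑ i, y i * b i, ∑ i, x i * a i) := by
  simp [mix_apply, Prod.ext_iff, Prod.fst_sum, Prod.snd_sum]

/-- If both sets contain `0`, a mixed word is dual to `v A ⊕ (1 - v) B` exactly when its
components are dual to `A` and `B`. -/
theorem mix_mem_dualE_mixSet {F : Type} [Field F] {n : ℕ} {A B : Set (Fin n → F)}
    (hA : 0 ∈ A) (hB : 0 ∈ B) (x y : Fin n → F) :
    mix x y ∈ dualE (mixSet A B) ↔ x ∈ dualE A ∧ y ∈ dualE B := by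
  constructor
  · intro h
    refine ⟨fun a ha => ?_, fun b hb => ?_⟩
    · have := h _ ⟨a, ha, 0, hB, rfl⟩
      rw [sum_mix_mul_mix] at this
      exact congrArg Prod.snd this
    · have := h _ ⟨0, hA, b, hb, rfl⟩
      rw [sum_mix_mul_mix] at this
      exact congrArg Prod.fst this
  · rintro ⟨hx, hy⟩ _ ⟨a, ha, b, hb, rfl⟩
    rw [sum_mix_mul_mix, hx a ha, hy b hb]
    rfl

/-- the hull of `C = vC₁ ⊕ (1-v)C₂` decomposes as
`C ∩ C^⊥ = v(C₁ ∩ C₁^⊥) ⊕ (1-v)(C₂ ∩ C₂^⊥)` (Euclidean duals). -/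
theorem stmt11 (p t n : ℕ) (hp : p.Prime) (ht : 0 < t)
    (F : Type) [Field F] [Fintype F] (hF : Fintype.card F = p ^ t)
    (C₁ C₂ : Submodule F (Fin n → F)) :
    mixSet (↑C₁ : Set (Fin n → F)) (↑C₂ : Set (Fin n → F)) ∩
        dualE (mixSet (↑C₁ : Set (Fin n → F)) (↑C₂ : Set (Fin n → F))) =
      mixSet ((↑C₁ : Set (Fin n → F)) ∩ dualE (↑C₁ : Set (Fin n → F)))
        ((↑C₂ : Set (Fin n → F)) ∩ dualE (↑C₂ : Set (Fin n → F))) := by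
  ext c
  constructor
  · rintro ⟨⟨x, hx, y, hy, rfl⟩, hd⟩
    obtain ⟨hdx, hdy⟩ := (mix_mem_dualE_mixSet C₁.zero_mem C₂.zero_mem x y).1 hd
    exact ⟨x, ⟨hx, hdx⟩, y, ⟨hy, hdy⟩, rfl⟩
  · rintro ⟨x, ⟨hx, hdx⟩, y, ⟨hy, hdy⟩, rfl⟩
    exact ⟨⟨x, hx, y, hy, rfl⟩,
      (mix_mem_dualE_mixSet C₁.zero_mem C₂.zero_mem x y).2 ⟨hdx, hdy⟩⟩
end

section
/- For every linear code C of length n over R, the Gray image of the Euclidean dual equals the Euclidean dual of the Gray image: Φ(C^⊥) = Φ(C)^⊥, where Φ(C)^⊥ is the Euclidean dual of Φ(C) in 𝔽_q^{2n} with respect to the standard inner product. -/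
open scoped BigOperators

/-- for every linear code `C` of length `n` over `R`,
`Φ(C^⊥) = Φ(C)^⊥` (Euclidean duals, the latter in `F^{ 2n } ≅ Fⁿ × Fⁿ`). -/
theorem stmt15 (p t n : ℕ) (hp : p.Prime) (ht : 0 < t)
    (F : Type) [Field F] [Fintype F] (hF : Fintype.card F = p ^ t)
    (C : Submodule (Rg F) (Fin n → Rg F)) :
    gray '' dualE (↑C : Set (Fin n → Rg F)) =
      dualProd (gray '' (↑C : Set (Fin n → Rg F))) := by
  ext x
  constructor
  · rintro ⟨c, hc, rfl⟩ _ ⟨d, hd, rfl⟩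
    have h := hc d hd
    have h₁ := congrArg Prod.fst h
    have h₂ := congrArg Prod.snd h
    simp only [Prod.fst_sum, Prod.snd_sum, Prod.fst_mul, Prod.snd_mul, Prod.fst_zero,
      Prod.snd_zero] at h₁ h₂
    simp only [gray, h₁, h₂, add_zero]
  · intro hx
    refine ⟨fun i => (x.1 i, x.2 i), fun d hd => ?_, rfl⟩
    have h₁ := hx _ ⟨_, C.smul_mem (1, 0) hd, rfl⟩
    have h₂ := hx _ ⟨_, C.smul_mem (0, 1) hd, rfl⟩
    simp only [gray, Pi.smul_apply, smul_eq_mul, Prod.fst_mul, Prod.snd_mul, one_mul, zero_mul,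
      mul_zero, Finset.sum_const_zero, add_zero, zero_add] at h₁ h₂
    ext
    · simpa only [Prod.fst_sum, Prod.fst_mul, Prod.fst_zero] using h₁
    · simpa only [Prod.snd_sum, Prod.snd_mul, Prod.snd_zero] using h₂
end

section
/- If C is a skew cyclic Euclidean LCD linear code of length n over R (with respect to θ_r), then its Gray image Φ(C) is an Euclidean LCD linear code of length 2n over 𝔽_q, and Φ(C), viewed in 𝔽_qⁿ × 𝔽_qⁿ, is invariant under the simultaneous skew cyclic shift (x, y) ↦ (σ(x), σ(y)), where σ(c₀,…,c_{n−1}) = (θ_r(c_{n−1}), θ_r(c₀), …, θ_r(c_{n−2})); that is, Φ(C) is (equivalent to) a skew 2-quasi-cyclic LCD code of length 2n over 𝔽_q. -/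
open scoped BigOperators

theorem gray_smul {F : Type} [Field F] {n : ℕ} (a : F) (c : Fin n → Rg F) :
    gray (((a, a) : Rg F) • c) = a • gray c := rfl

theorem isLinCode_gray_image {F : Type} [Field F] {n : ℕ}
    (C : Submodule (Rg F) (Fin n → Rg F)) :
    IsLinCode F (gray '' (↑C : Set (Fin n → Rg F))) := by
  refine ⟨{ carrier := gray '' (↑C : Set (Fin n → Rg F))
            add_mem' := ?_, zero_mem' := ⟨0, C.zero_mem, rfl⟩, smul_mem' := ?_ }, rfl⟩
  · rintro _ _ ⟨c, hc, rfl⟩ ⟨d, hd, rfl⟩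
    exact ⟨c + d, C.add_mem hc hd, rfl⟩
  · rintro a _ ⟨c, hc, rfl⟩
    exact ⟨_, C.smul_mem (a, a) hc, gray_smul a c⟩

/-- The Gray preimage of a word orthogonal to the Gray image of `C` lies in the dual of `C`. -/
theorem mem_dualE_of_gray_mem_dualProd {F : Type} [Field F] {n : ℕ}
    (C : Submodule (Rg F) (Fin n → Rg F)) {c : Fin n → Rg F}
    (h : gray c ∈ dualProd (gray '' (↑C : Set (Fin n → Rg F)))) :
    c ∈ dualE (↑C : Set (Fin n → Rg F)) := by
  intro d hd
  have h₁ := h _ ⟨_, C.smul_mem ((1, 0) : Rg F) hd, rfl⟩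
  have h₂ := h _ ⟨_, C.smul_mem ((0, 1) : Rg F) hd, rfl⟩
  simp [gray] at h₁ h₂
  exact Prod.ext (by simpa [Prod.fst_sum] using h₁) (by simpa [Prod.snd_sum] using h₂)

theorem thR_eq_pow {F : Type} [Field F] (p r : ℕ) [ExpChar F p] (z : Rg F) :
    thR F (p ^ r) z = (z.1 ^ p ^ r, z.2 ^ p ^ r) := by
  simp [thR, sub_pow_expChar_pow]

theorem gray_skewShift {F : Type} [Field F] {n : ℕ} (p r : ℕ) [ExpChar F p]
    (c : Fin n → Rg F) :
    gray (skewShift (thR F (p ^ r)) 1 c) =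
      (skewShift (fun a : F => a ^ p ^ r) 1 (gray c).1,
        skewShift (fun a : F => a ^ p ^ r) 1 (gray c).2) := by
  refine Prod.ext (funext fun i => ?_) (funext fun i => ?_) <;>
  · simp only [gray, skewShift, thR_eq_pow]
    split_ifs <;> simp

/-- if `C` is a skew cyclic Euclidean LCD linear code of length `n` over
`R` (w.r.t. `θ_r`), then `Φ(C)` is an Euclidean LCD linear code of length `2n` over
`𝔽_q` which is invariant under the simultaneous skew cyclic shift
`(x, y) ↦ (σ(x), σ(y))`, i.e. a skew 2-quasi-cyclic LCD code. -/
theorem stmt16 (p t r n : ℕ) (hp : p.Prime) (ht : 0 < t) (hr : r ∣ t)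
    (F : Type) [Field F] [Fintype F] (hF : Fintype.card F = p ^ t)
    (C : Submodule (Rg F) (Fin n → Rg F))
    (hcyc : SkewConsta (thR F (p ^ r)) (1 : Rg F) (↑C : Set (Fin n → Rg F)))
    (hlcd : (↑C : Set (Fin n → Rg F)) ∩ dualE (↑C : Set (Fin n → Rg F)) = {0}) :
    IsLinCode F (gray '' (↑C : Set (Fin n → Rg F))) ∧
    (gray '' (↑C : Set (Fin n → Rg F))) ∩
        dualProd (gray '' (↑C : Set (Fin n → Rg F))) = {0} ∧
    ∀ z ∈ gray '' (↑C : Set (Fin n → Rg F)),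
      ((skewShift (fun a : F => a ^ p ^ r) 1 z.1,
        skewShift (fun a : F => a ^ p ^ r) 1 z.2) : (Fin n → F) × (Fin n → F)) ∈
        gray '' (↑C : Set (Fin n → Rg F)) := by
  have : Fact p.Prime := ⟨hp⟩
  have : CharP F p := charP_of_card_eq_prime_pow hF
  refine ⟨isLinCode_gray_image C, ?_, ?_⟩
  · refine Set.eq_singleton_iff_unique_mem.2 ⟨⟨⟨0, C.zero_mem, rfl⟩, by simp [dualProd]⟩, ?_⟩
    rintro _ ⟨⟨c, hc, rfl⟩, h⟩
    have hc₀ : c ∈ ({0} : Set (Fin n → Rg F)) :=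
      hlcd ▸ ⟨hc, mem_dualE_of_gray_mem_dualProd C h⟩
    rw [Set.mem_singleton_iff.1 hc₀]
    rfl
  · rintro _ ⟨c, hc, rfl⟩
    exact ⟨_, hcyc c hc, gray_skewShift p r c⟩
end

section
/- For nonzero linear codes C₁, C₂ of length n over 𝔽_q with dim C₁ = k₁ and dim C₂ = k₂, the Gray image Φ(C) of C = vC₁ ⊕ (1−v)C₂ is a linear code over 𝔽_q of length 2n, dimension k₁ + k₂, and minimum Hamming distance d_H(Φ(C)) = min(d_H(C₁), d_H(C₂)), where d_H denotes the minimum Hamming weight of a nonzero codeword. -/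
open scoped BigOperators

/-- Minimum Hamming distance of a (nonzero) code in `Fⁿ`: the minimum Hamming weight
of a nonzero codeword. -/
noncomputable def minDist {F : Type} [Field F] [DecidableEq F] {n : ℕ} (S : Set (Fin n → F)) : ℕ :=
  sInf {w | ∃ c ∈ S, c ≠ 0 ∧ hammingNorm c = w}

/-- Minimum Hamming distance of a (nonzero) code in `F^{2n} ≅ Fⁿ × Fⁿ`: the Hamming
weight of `(x, y)` is `wt(x) + wt(y)`. -/
noncomputable def minDistProd {F : Type} [Field F] [DecidableEq F] {n : ℕ}
    (S : Set ((Fin n → F) × (Fin n → F))) : ℕ :=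
  sInf {w | ∃ z ∈ S, z ≠ 0 ∧ hammingNorm z.1 + hammingNorm z.2 = w}

theorem gray_mix {F : Type} [Field F] {n : ℕ} (x y : Fin n → F) : gray (mix x y) = (y, x) := by
  ext i <;> simp [gray, mix, vv]

theorem gray_image_mixSet {F : Type} [Field F] {n : ℕ} (A B : Set (Fin n → F)) :
    gray '' mixSet A B = B ×ˢ A := by
  ext ⟨y, x⟩
  constructor
  · rintro ⟨_, ⟨a, ha, b, hb, rfl⟩, h⟩
    rw [gray_mix] at h
    exact h ▸ ⟨hb, ha⟩
  · rintro ⟨hy, hx⟩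
    exact ⟨mix x y, ⟨x, hx, y, hy, rfl⟩, gray_mix x y⟩

theorem Submodule.finrank_prod_eq_add {K V W : Type*} [Field K] [AddCommGroup V] [Module K V]
    [AddCommGroup W] [Module K W] (p : Submodule K V) (q : Submodule K W)
    [FiniteDimensional K p] [FiniteDimensional K q] :
    Module.finrank K (p.prod q) = Module.finrank K p + Module.finrank K q := by
  let e : p.prod q ≃ₗ[K] p × q :=
    { toFun := fun z => (⟨z.1.1, z.2.1⟩, ⟨z.1.2, z.2.2⟩)
      invFun := fun z => ⟨(z.1, z.2), z.1.2, z.2.2⟩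
      map_add' := fun _ _ => rfl
      map_smul' := fun _ _ => rfl }
  rw [e.finrank_eq, Module.finrank_prod]

theorem minDist_le {F : Type} [Field F] [DecidableEq F] {n : ℕ} {S : Set (Fin n → F)}
    {c : Fin n → F} (hc : c ∈ S) (h0 : c ≠ 0) : minDist S ≤ hammingNorm c :=
  Nat.sInf_le ⟨c, hc, h0, rfl⟩

theorem minDistProd_le {F : Type} [Field F] [DecidableEq F] {n : ℕ}
    {S : Set ((Fin n → F) × (Fin n → F))} {z : (Fin n → F) × (Fin n → F)} (hz : z ∈ S)
    (h0 : z ≠ 0) : minDistProd S ≤ hammingNorm z.1 + hammingNorm z.2 :=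
  Nat.sInf_le ⟨z, hz, h0, rfl⟩

theorem exists_hammingNorm_eq_minDist {F : Type} [Field F] [DecidableEq F] {n : ℕ}
    {C : Submodule F (Fin n → F)} (hC : C ≠ ⊥) :
    ∃ c ∈ C, c ≠ 0 ∧ hammingNorm c = minDist (C : Set (Fin n → F)) := by
  obtain ⟨c, hc, h0⟩ := C.exists_mem_ne_zero_of_ne_bot hC
  exact Nat.sInf_mem (s := {w | ∃ c ∈ (C : Set (Fin n → F)), c ≠ 0 ∧ hammingNorm c = w})
    ⟨_, c, hc, h0, rfl⟩

theorem minDistProd_prod {F : Type} [Field F] [DecidableEq F] {n : ℕ}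
    {C D : Submodule F (Fin n → F)} (hC : C ≠ ⊥) (hD : D ≠ ⊥) :
    minDistProd ((C : Set (Fin n → F)) ×ˢ (D : Set (Fin n → F))) =
      min (minDist (C : Set (Fin n → F))) (minDist (D : Set (Fin n → F))) := by
  obtain ⟨c, hc, hc0, hcw⟩ := exists_hammingNorm_eq_minDist hC
  obtain ⟨d, hd, hd0, hdw⟩ := exists_hammingNorm_eq_minDist hD
  apply le_antisymm
  · refine le_min ?_ ?_
    · simpa [hcw] using minDistProd_le (S := (C : Set (Fin n → F)) ×ˢ (D : Set (Fin n → F)))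
        (z := (c, 0)) ⟨hc, D.zero_mem⟩ (by simpa [Prod.ext_iff] using hc0)
    · simpa [hdw] using minDistProd_le (S := (C : Set (Fin n → F)) ×ˢ (D : Set (Fin n → F)))
        (z := (0, d)) ⟨C.zero_mem, hd⟩ (by simpa [Prod.ext_iff] using hd0)
  · refine le_csInf ⟨_, (c, 0), ⟨hc, D.zero_mem⟩, by simpa [Prod.ext_iff] using hc0,
      rfl⟩ ?_
    rintro _ ⟨⟨x, y⟩, ⟨hx, hy⟩, h0, rfl⟩
    by_cases hx0 : x = 0
    · have hy0 : y ≠ 0 := fun hy0 => h0 (Prod.ext hx0 hy0)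
      exact (min_le_right _ _).trans ((minDist_le hy hy0).trans (Nat.le_add_left _ _))
    · exact (min_le_left _ _).trans ((minDist_le hx hx0).trans (Nat.le_add_right _ _))

/-- for nonzero linear codes `C₁, C₂` of length `n` over `𝔽_q` with
dimensions `k₁, k₂`, the Gray image `Φ(C)` of `C = vC₁ ⊕ (1-v)C₂` is a linear code over
`𝔽_q` of length `2n`, dimension `k₁ + k₂`, and minimum Hamming distance
`min(d_H(C₁), d_H(C₂))`. -/
theorem stmt17 (p t n k₁ k₂ : ℕ) (hp : p.Prime) (ht : 0 < t)
    (F : Type) [Field F] [Fintype F] [DecidableEq F] (hF : Fintype.card F = p ^ t)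
    (C₁ C₂ : Submodule F (Fin n → F)) (hC₁ : C₁ ≠ ⊥) (hC₂ : C₂ ≠ ⊥)
    (hk₁ : Module.finrank F C₁ = k₁) (hk₂ : Module.finrank F C₂ = k₂) :
    (∃ D : Submodule F ((Fin n → F) × (Fin n → F)),
      (↑D : Set ((Fin n → F) × (Fin n → F))) =
          gray '' mixSet (↑C₁ : Set (Fin n → F)) (↑C₂ : Set (Fin n → F)) ∧
        Module.finrank F D = k₁ + k₂) ∧
    minDistProd (gray '' mixSet (↑C₁ : Set (Fin n → F)) (↑C₂ : Set (Fin n → F))) =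
      min (minDist (↑C₁ : Set (Fin n → F))) (minDist (↑C₂ : Set (Fin n → F))) := by
  rw [gray_image_mixSet]
  refine ⟨⟨C₂.prod C₁, Submodule.prod_coe C₂ C₁, ?_⟩, ?_⟩
  · rw [Submodule.finrank_prod_eq_add, hk₁, hk₂, add_comm]
  · rw [minDistProd_prod hC₂ hC₁, min_comm]
end
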